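/- arXiv:2403.03546 — 9 statements merged into one kernel-verified Lean document; each statement's English description precedes it below -/
import Mathlib

section
/- Let T be a subcategory of C. Then T is a tilting subcategory (i.e., pd(T) ≤ 1 and T is a generator of T^⊥₁) if and only if the following three conditions hold: (T1) pd(T) ≤ 1; (T2') Ext¹(T,T') = 0 for all T, T' ∈ T; (T3) every projective object P of C admits a short exact sequence 0 → P → T⁰ → T¹ → 0 with T⁰, T¹ ∈ T. -/
open CategoryTheory Category Limits Abelian

universe w v u

variable {C : Type u} [Category.{v} C] [Abelian C]
  [EnoughProjectives C] [EnoughInjectives C] [HasExt.{w} C]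

/-- `f, g` form a short exact sequence `0 → A → B → X → 0`. -/
def IsShortExactSeq {A B X : C} (f : A ⟶ B) (g : B ⟶ X) : Prop :=
  ∃ h : f ≫ g = 0, (ShortComplex.mk f g h).ShortExact

/-- `f, g` form a right exact sequence `A → B → X → 0`
(exact at `B` and at `X`, i.e. `g` is an epimorphism). -/
def IsRightExactSeq {A B X : C} (f : A ⟶ B) (g : B ⟶ X) : Prop :=
  ∃ h : f ≫ g = 0, (ShortComplex.mk f g h).Exact ∧ Epi g

/-- A (full, additive) subcategory, given by its class of objects: closed under
isomorphisms, direct summands and finite direct sums. -/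
def IsSubcat (𝒯 : Set C) : Prop :=
  (∀ ⦃X Y : C⦄, (X ≅ Y) → X ∈ 𝒯 → Y ∈ 𝒯) ∧
  (∀ ⦃X Y : C⦄, (X ⊞ Y) ∈ 𝒯 → X ∈ 𝒯 ∧ Y ∈ 𝒯) ∧
  (∀ ⦃X Y : C⦄, X ∈ 𝒯 → Y ∈ 𝒯 → (X ⊞ Y) ∈ 𝒯)

/-- `𝒯^⊥₁ = {X | Ext¹(T, X) = 0 for all T ∈ 𝒯}`. -/
def rightPerp1 (𝒯 : Set C) : Set C :=
  {X | ∀ T ∈ 𝒯, Subsingleton (Ext T X 1)}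

/-- `^⊥₁𝒱 = {X | Ext¹(X, V) = 0 for all V ∈ 𝒱}`. -/
def leftPerp1 (𝒱 : Set C) : Set C :=
  {X | ∀ V ∈ 𝒱, Subsingleton (Ext X V 1)}

/-- `Defl 𝒯`: objects admitting an epimorphism from an object of `𝒯`. -/
def Defl (𝒯 : Set C) : Set C :=
  {F | ∃ T ∈ 𝒯, ∃ g : T ⟶ F, Epi g}

/-- `𝒰` is a generator of `𝒱`: `𝒰 ⊆ 𝒱` and every `V ∈ 𝒱` fits in a short exact
sequence `0 → V' → U → V → 0` with `U ∈ 𝒰`, `V' ∈ 𝒱`. -/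
def IsGeneratorOf (𝒰 𝒱 : Set C) : Prop :=
  𝒰 ⊆ 𝒱 ∧ ∀ V ∈ 𝒱, ∃ V' ∈ 𝒱, ∃ U ∈ 𝒰, ∃ (f : V' ⟶ U) (g : U ⟶ V), IsShortExactSeq f g

/-- `f : P ⟶ T₀` is a left `𝒯`-approximation of `P`. -/
def IsLeftApprox (𝒯 : Set C) {P T₀ : C} (f : P ⟶ T₀) : Prop :=
  T₀ ∈ 𝒯 ∧ ∀ T ∈ 𝒯, ∀ φ : P ⟶ T, ∃ ψ : T₀ ⟶ T, f ≫ ψ = φ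

/-- `𝒯` is a support `τ`-tilting subcategory. -/
def IsSupportTauTilting (𝒯 : Set C) : Prop :=
  IsGeneratorOf 𝒯 (Defl 𝒯) ∧
  (∀ T ∈ 𝒯, ∀ D ∈ Defl 𝒯, Subsingleton (Ext T D 1)) ∧
  (∀ P : C, Projective P → ∃ T₀ ∈ 𝒯, ∃ T₁ ∈ 𝒯, ∃ (f : P ⟶ T₀) (g : T₀ ⟶ T₁),
    IsRightExactSeq f g ∧ IsLeftApprox 𝒯 f)

/-- `(𝒰, 𝒱)` is a `τ`-cotorsion pair. -/
def IsTauCotorsionPair (𝒰 𝒱 : Set C) : Prop :=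
  𝒰 = leftPerp1 𝒱 ∧
  ∀ P : C, Projective P → ∃ V₀ ∈ 𝒰 ∩ 𝒱, ∃ U₀ ∈ 𝒰, ∃ (f : P ⟶ V₀) (g : V₀ ⟶ U₀),
    IsRightExactSeq f g ∧ IsLeftApprox 𝒱 f

/-- `(𝒰, 𝒱)` is a cotorsion pair (both classes closed under direct summands). -/
def IsCotorsionPair (𝒰 𝒱 : Set C) : Prop :=
  (∀ ⦃X Y : C⦄, (X ⊞ Y) ∈ 𝒰 → X ∈ 𝒰 ∧ Y ∈ 𝒰) ∧
  (∀ ⦃X Y : C⦄, (X ⊞ Y) ∈ 𝒱 → X ∈ 𝒱 ∧ Y ∈ 𝒱) ∧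
  (∀ U ∈ 𝒰, ∀ V ∈ 𝒱, Subsingleton (Ext U V 1)) ∧
  (∀ X : C, ∃ V' ∈ 𝒱, ∃ U' ∈ 𝒰, ∃ (f : V' ⟶ U') (g : U' ⟶ X), IsShortExactSeq f g) ∧
  (∀ X : C, ∃ V' ∈ 𝒱, ∃ U' ∈ 𝒰, ∃ (f : X ⟶ V') (g : V' ⟶ U'), IsShortExactSeq f g)

/-- `𝒱` is a torsion class: closed under extensions and epimorphic images. -/
def IsTorsionClass (𝒱 : Set C) : Prop :=
  (∀ ⦃A B X : C⦄ (f : A ⟶ B) (g : B ⟶ X),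
    IsShortExactSeq f g → A ∈ 𝒱 → X ∈ 𝒱 → B ∈ 𝒱) ∧
  (∀ ⦃A B : C⦄ (g : A ⟶ B), Epi g → A ∈ 𝒱 → B ∈ 𝒱)

section ShortExactSeq

variable {D : Type u} [Category.{v} D] [Abelian D] {A B X Z : D} {f : A ⟶ B} {g : B ⟶ X}

lemma IsShortExactSeq.of_isPushout {E : D} {a : A ⟶ Z} {b : B ⟶ E} {f' : Z ⟶ E}
    (sq : IsPushout f a b f') (h : IsShortExactSeq f g) :
    ∃ g' : E ⟶ X, IsShortExactSeq f' g' := by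
  obtain ⟨w, hS⟩ := h
  have : Mono f := hS.mono_f
  have : Epi g := hS.epi_g
  have : Mono f' := MorphismProperty.of_isPushout
    (P := MorphismProperty.monomorphisms D) sq.flip ‹Mono f›
  have hg : b ≫ sq.desc g 0 (by simp [w]) = g := sq.inl_desc ..
  have : Epi (sq.desc g 0 (by simp [w])) := by
    have : Epi (b ≫ sq.desc g 0 (by simp [w])) := by rwa [hg]
    exact epi_of_epi b _
  refine ⟨sq.desc g 0 (by simp [w]), sq.inr_desc .., .mk' ?_ ‹_› ‹_›⟩
  refine ShortComplex.exact_of_g_is_cokernel _ (CokernelCofork.IsColimit.ofπ' _ _ fun {W} k hk ↦ ?_)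
  have hbk : f ≫ b ≫ k = 0 := by
    rw [sq.w_assoc, hk, comp_zero]
  refine ⟨hS.exact.desc (b ≫ k) hbk, sq.hom_ext ?_ ?_⟩
  · rw [reassoc_of% hg]
    exact hS.exact.g_desc _ _
  · simpa using hk.symm

lemma IsShortExactSeq.of_isPullback {E : D} {a : Z ⟶ X} {b : E ⟶ B} {g' : E ⟶ Z}
    (sq : IsPullback b g' g a) (h : IsShortExactSeq f g) :
    ∃ f' : A ⟶ E, IsShortExactSeq f' g' := by
  obtain ⟨w, hS⟩ := h
  have : Mono f := hS.mono_f
  have : Epi g := hS.epi_g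
  have : Epi g' := MorphismProperty.of_isPullback
    (P := MorphismProperty.epimorphisms D) sq ‹Epi g›
  have hf : sq.lift f 0 (by simp [w]) ≫ b = f := sq.lift_fst ..
  have : Mono (sq.lift f 0 (by simp [w])) := by
    have : Mono (sq.lift f 0 (by simp [w]) ≫ b) := by rwa [hf]
    exact mono_of_mono _ b
  refine ⟨sq.lift f 0 (by simp [w]), sq.lift_snd .., .mk' ?_ ‹_› ‹_›⟩
  refine ShortComplex.exact_of_f_is_kernel _ (KernelFork.IsLimit.ofι' _ _ fun {W} k hk ↦ ?_)
  have hbk : (k ≫ b) ≫ g = 0 := by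
    rw [assoc, sq.w, reassoc_of% hk, zero_comp]
  refine ⟨hS.exact.lift (k ≫ b) hbk, sq.hom_ext ?_ ?_⟩
  · rw [assoc, hf]
    exact hS.exact.lift_f _ _
  · simpa using hk.symm

lemma isShortExactSeq_cokernel (f : A ⟶ B) [Mono f] : IsShortExactSeq f (cokernel.π f) :=
  ⟨cokernel.condition f, .mk' (ShortComplex.exact_cokernel f) ‹_› inferInstance⟩

lemma isShortExactSeq_kernel (g : B ⟶ X) [Epi g] : IsShortExactSeq (kernel.ι g) g :=
  ⟨kernel.condition g, .mk' (ShortComplex.exact_kernel g) inferInstance ‹_›⟩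

variable [HasExt.{w} D]

/-- A morphism out of the left term extends to the middle term when the relevant `Ext¹`
vanishes. -/
lemma IsShortExactSeq.exists_extension (h : IsShortExactSeq f g) [Subsingleton (Ext X Z 1)]
    (φ : A ⟶ Z) : ∃ ψ : B ⟶ Z, f ≫ ψ = φ := by
  obtain ⟨w, hS⟩ := h
  obtain ⟨y, hy⟩ := Ext.contravariant_sequence_exact₁ hS Z (Ext.mk₀ φ) (add_zero 1)
    (Subsingleton.elim _ _)
  obtain ⟨ψ, rfl⟩ := Ext.addEquiv₀.symm.surjective y
  exact ⟨ψ, Ext.addEquiv₀.symm.injective (by simpa using hy)⟩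

lemma IsShortExactSeq.nonempty_iso_biprod (h : IsShortExactSeq f g) [Subsingleton (Ext X A 1)] :
    Nonempty (B ≅ A ⊞ X) := by
  obtain ⟨r, hr⟩ := h.exists_extension (𝟙 A)
  obtain ⟨w, hS⟩ := h
  exact ⟨(ShortComplex.Splitting.ofExactOfRetraction _ hS.exact r hr
    hS.epi_g).isoBinaryBiproduct⟩

lemma IsShortExactSeq.subsingleton_ext_from_middle (h : IsShortExactSeq f g) {n : ℕ}
    [Subsingleton (Ext A Z n)] [Subsingleton (Ext X Z n)] : Subsingleton (Ext B Z n) := by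
  obtain ⟨w, hS⟩ := h
  refine subsingleton_of_forall_eq 0 fun x ↦ ?_
  obtain ⟨y, rfl⟩ := Ext.contravariant_sequence_exact₂ hS Z x (Subsingleton.elim _ _)
  rw [Subsingleton.elim y 0, Ext.comp_zero]

lemma IsShortExactSeq.mem_rightPerp1_middle {𝒯 : Set D} (h : IsShortExactSeq f g)
    (hA : A ∈ rightPerp1 𝒯) (hX : X ∈ rightPerp1 𝒯) : B ∈ rightPerp1 𝒯 := by
  obtain ⟨w, hS⟩ := h
  intro T hT
  have := hA T hT
  have := hX T hT
  refine subsingleton_of_forall_eq 0 fun x ↦ ?_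
  obtain ⟨y, rfl⟩ := Ext.covariant_sequence_exact₂ T hS x (Subsingleton.elim _ _)
  rw [Subsingleton.elim y 0, Ext.zero_comp]

lemma IsShortExactSeq.mem_rightPerp1_right {𝒯 : Set D}
    (h𝒯 : ∀ T ∈ 𝒯, ∀ X : D, Subsingleton (Ext T X 2)) (h : IsShortExactSeq f g)
    (hB : B ∈ rightPerp1 𝒯) : X ∈ rightPerp1 𝒯 := by
  obtain ⟨w, hS⟩ := h
  intro T hT
  have := hB T hT
  have := h𝒯 T hT A
  refine subsingleton_of_forall_eq 0 fun x ↦ ?_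
  obtain ⟨y, rfl⟩ := Ext.covariant_sequence_exact₃ T hS x one_add_one_eq_two
    (Subsingleton.elim _ _)
  rw [Subsingleton.elim y 0, Ext.zero_comp]

end ShortExactSeq

/-- Every projective object has a `𝒯`-coresolution of length one if `𝒯` has projective
dimension at most one and generates `𝒯^⊥₁`. -/
lemma IsGeneratorOf.exists_coresolution_of_projective
    {D : Type u} [Category.{v} D] [Abelian D] [EnoughInjectives D] [HasExt.{w} D]
    {𝒯 : Set D} (h𝒯 : IsSubcat 𝒯)
    (hpd : ∀ T ∈ 𝒯, ∀ X : D, Subsingleton (Ext T X 2)) (hgen : IsGeneratorOf 𝒯 (rightPerp1 𝒯))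
    (P : D) [Projective P] : ∃ T₀ ∈ 𝒯, ∃ T₁ ∈ 𝒯, ∃ (f : P ⟶ T₀) (g : T₀ ⟶ T₁),
      IsShortExactSeq f g := by
  have hI : Injective.under P ∈ rightPerp1 𝒯 :=
    fun T _ ↦ Ext.subsingleton_of_injective T (Injective.under P) 0
  have hP := isShortExactSeq_cokernel (Injective.ι P)
  obtain ⟨V, hV, T₁, hT₁, i, p, hp⟩ := hgen.2 _ (hP.mem_rightPerp1_right hpd hI)
  have sq := IsPullback.of_hasPullback (cokernel.π (Injective.ι P)) p
  obtain ⟨j, hj⟩ := hP.of_isPullback sq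
  obtain ⟨k, hk⟩ := hp.of_isPullback sq.flip
  obtain ⟨V', hV', T, hT, i', p', hp'⟩ := hgen.2 _ (hk.mem_rightPerp1_middle hV hI)
  have := hV' T₁ hT₁
  have := Ext.subsingleton_of_projective P V' 0
  have := hj.subsingleton_ext_from_middle (Z := V') (n := 1)
  obtain ⟨e⟩ := hp'.nonempty_iso_biprod
  exact ⟨_, (h𝒯.2.1 (h𝒯.1 e hT)).2, T₁, hT₁, j, _, hj⟩

/-- If projectives have `𝒯`-coresolutions of length one, every object embeds into an object of
`𝒯^⊥₁` with cokernel in `𝒯`. -/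
lemma exists_mono_to_rightPerp1
    {D : Type u} [Category.{v} D] [Abelian D] [EnoughProjectives D] [HasExt.{w} D]
    {𝒯 : Set D}
    (hpd : ∀ T ∈ 𝒯, ∀ X : D, Subsingleton (Ext T X 2)) (hrigid : 𝒯 ⊆ rightPerp1 𝒯)
    (hproj : ∀ P : D, Projective P → ∃ T₀ ∈ 𝒯, ∃ T₁ ∈ 𝒯, ∃ (f : P ⟶ T₀) (g : T₀ ⟶ T₁),
      IsShortExactSeq f g) (K : D) :
    ∃ F ∈ rightPerp1 𝒯, ∃ S ∈ 𝒯, ∃ (f : K ⟶ F) (g : F ⟶ S), IsShortExactSeq f g := by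
  obtain ⟨T₀, hT₀, T₁, hT₁, f, g, hfg⟩ := hproj (Projective.over K) inferInstance
  have sq := IsPushout.of_hasPushout f (Projective.π K)
  obtain ⟨g', hg'⟩ := hfg.of_isPushout sq
  have : Epi (pushout.inl f (Projective.π K)) := MorphismProperty.of_isPushout
    (P := MorphismProperty.epimorphisms D) sq (inferInstance : Epi (Projective.π K))
  exact ⟨_, (isShortExactSeq_kernel (pushout.inl f (Projective.π K))).mem_rightPerp1_right hpd
    (hrigid hT₀), T₁, hT₁, _, g', hg'⟩

lemma isGeneratorOf_rightPerp1
    {D : Type u} [Category.{v} D] [Abelian D] [EnoughProjectives D] [HasExt.{w} D]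
    {𝒯 : Set D} (h𝒯 : IsSubcat 𝒯)
    (hpd : ∀ T ∈ 𝒯, ∀ X : D, Subsingleton (Ext T X 2)) (hrigid : 𝒯 ⊆ rightPerp1 𝒯)
    (hproj : ∀ P : D, Projective P → ∃ T₀ ∈ 𝒯, ∃ T₁ ∈ 𝒯, ∃ (f : P ⟶ T₀) (g : T₀ ⟶ T₁),
      IsShortExactSeq f g) : IsGeneratorOf 𝒯 (rightPerp1 𝒯) := by
  refine ⟨hrigid, fun V hV ↦ ?_⟩
  obtain ⟨T₀, hT₀, T₁, hT₁, f, g, hfg⟩ := hproj (Projective.over V) inferInstance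
  have := hV T₁ hT₁
  obtain ⟨q, hq⟩ := hfg.exists_extension (Projective.π V)
  have : Epi q := epi_of_epi_fac hq
  obtain ⟨F, hF, S, hS, i, p, hip⟩ := exists_mono_to_rightPerp1 hpd hrigid hproj (kernel q)
  have sq := IsPushout.of_hasPushout (kernel.ι q) i
  obtain ⟨r, hr⟩ := (isShortExactSeq_kernel q).of_isPushout sq
  obtain ⟨s, hs⟩ := hip.of_isPushout sq.flip
  have := hrigid hT₀ S hS
  obtain ⟨e⟩ := hs.nonempty_iso_biprod
  exact ⟨F, hF, _, h𝒯.1 e.symm (h𝒯.2.2 hT₀ hS), _, r, hr⟩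

theorem stmt_0 (𝒯 : Set C) (h𝒯 : IsSubcat 𝒯) :
    ((∀ T ∈ 𝒯, ∀ X : C, Subsingleton (Ext T X 2)) ∧ IsGeneratorOf 𝒯 (rightPerp1 𝒯)) ↔
      ((∀ T ∈ 𝒯, ∀ X : C, Subsingleton (Ext T X 2)) ∧
       (∀ T ∈ 𝒯, ∀ T' ∈ 𝒯, Subsingleton (Ext T T' 1)) ∧
       (∀ P : C, Projective P → ∃ T₀ ∈ 𝒯, ∃ T₁ ∈ 𝒯,
          ∃ (f : P ⟶ T₀) (g : T₀ ⟶ T₁), IsShortExactSeq f g)) := by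
  constructor
  · rintro ⟨hpd, hgen⟩
    exact ⟨hpd, fun T hT T' hT' ↦ hgen.1 hT' T hT,
      fun P _ ↦ hgen.exists_coresolution_of_projective h𝒯 hpd P⟩
  · rintro ⟨hpd, hrigid, hproj⟩
    exact ⟨hpd, isGeneratorOf_rightPerp1 h𝒯 hpd (fun T' hT' T hT ↦ hrigid T hT T' hT') hproj⟩
end

section
/- Let T be a subcategory of C such that Defl(T) = T^⊥₁. Then pd(T) ≤ 1, i.e., Ext²(T,X) = 0 for all T ∈ T and X ∈ C. -/
open CategoryTheory Category Limits Abelian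

universe w v u

variable {C : Type u} [Category.{v} C] [Abelian C]
  [EnoughProjectives C] [EnoughInjectives C] [HasExt.{w} C]

theorem stmt_3 (𝒯 : Set C) (h𝒯 : IsSubcat 𝒯)
    (hDefl : Defl 𝒯 = rightPerp1 𝒯) :
    ∀ T ∈ 𝒯, ∀ X : C, Subsingleton (Ext T X 2) := by
  intro T hT X
  have hS : (ShortComplex.mk (Injective.ι X) (cokernel.π (Injective.ι X))
      (cokernel.condition _)).ShortExact :=
    { exact := ShortComplex.exact_cokernel _ }
  have hI : Injective.under X ∈ Defl 𝒯 := by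
    rw [hDefl]
    exact fun T' _ => Ext.subsingleton_of_injective T' (Injective.under X) 0
  obtain ⟨T₀, hT₀, g, hg⟩ := hI
  have hQ : cokernel (Injective.ι X) ∈ rightPerp1 𝒯 := by
    rw [← hDefl]
    exact ⟨T₀, hT₀, g ≫ cokernel.π _, epi_comp _ _⟩
  have hQT : Subsingleton (Ext T (cokernel (Injective.ι X)) 1) := hQ T hT
  refine subsingleton_of_forall_eq 0 fun x => ?_
  obtain ⟨y, rfl⟩ := Ext.covariant_sequence_exact₁ T hS x
    (Ext.eq_zero_of_injective (n := 1) _) (n₀ := 1) rfl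
  rw [show y = 0 from hQT.elim _ _, Ext.zero_comp]
end

section
/- Let T be a subcategory of C such that Defl(T) = T^⊥₁, and suppose that every object D ∈ T^⊥₁ admits an epimorphism g : T → D with T ∈ T which is a right T-approximation of D (every morphism from an object of T to D factors through g). Then T is a tilting subcategory, i.e., pd(T) ≤ 1 and T is a generator of T^⊥₁. -/
open CategoryTheory Category Limits Abelian

universe w v u

variable {C : Type u} [Category.{v} C] [Abelian C]
  [EnoughProjectives C] [EnoughInjectives C] [HasExt.{w} C]

/-- If `0 → X₁ → X₂ → X₃ → 0` is short exact with `X₂` injective, then `Extⁿ(T, X₃) = 0`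
implies `Extⁿ⁺¹(T, X₁) = 0`. -/
theorem subsingleton_ext_succ_of_injective {C : Type u} [Category.{v} C] [Abelian C]
    [HasExt.{w} C] {S : ShortComplex C} (hS : S.ShortExact) [Injective S.X₂] (T : C) (n : ℕ)
    [Subsingleton (Ext T S.X₃ n)] : Subsingleton (Ext T S.X₁ (n + 1)) := by
  refine subsingleton_of_forall_eq 0 fun x => ?_
  obtain ⟨y, rfl⟩ := Ext.covariant_sequence_exact₁ T hS x (Ext.eq_zero_of_injective _) rfl
  rw [Subsingleton.elim y 0, Ext.zero_comp]

/-- If `0 → X₁ → X₂ → X₃ → 0` is short exact, `Ext¹(T, X₂) = 0` and every morphism `T ⟶ X₃`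
factors through `X₂`, then `Ext¹(T, X₁) = 0`. -/
theorem subsingleton_ext_one_of_lift {C : Type u} [Category.{v} C] [Abelian C]
    [HasExt.{w} C] {S : ShortComplex C} (hS : S.ShortExact) (T : C)
    [Subsingleton (Ext T S.X₂ 1)] (hlift : ∀ φ : T ⟶ S.X₃, ∃ ψ : T ⟶ S.X₂, ψ ≫ S.g = φ) :
    Subsingleton (Ext T S.X₁ 1) := by
  refine subsingleton_of_forall_eq 0 fun x => ?_
  obtain ⟨y, rfl⟩ := Ext.covariant_sequence_exact₁ T hS x (Subsingleton.elim _ _) (zero_add 1)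
  obtain ⟨φ, rfl⟩ := (Ext.mk₀_bijective T S.X₃).2 y
  obtain ⟨ψ, rfl⟩ := hlift φ
  rw [← Ext.mk₀_comp_mk₀, Ext.comp_assoc_of_second_deg_zero, hS.comp_extClass, Ext.comp_zero]

theorem stmt_4 (𝒯 : Set C) (h𝒯 : IsSubcat 𝒯)
    (hDefl : Defl 𝒯 = rightPerp1 𝒯)
    (happrox : ∀ D ∈ rightPerp1 𝒯, ∃ T₀ ∈ 𝒯, ∃ g : T₀ ⟶ D, Epi g ∧
      ∀ T ∈ 𝒯, ∀ φ : T ⟶ D, ∃ ψ : T ⟶ T₀, ψ ≫ g = φ) :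
    (∀ T ∈ 𝒯, ∀ X : C, Subsingleton (Ext T X 2)) ∧ IsGeneratorOf 𝒯 (rightPerp1 𝒯) := by
  have h𝒯perp : 𝒯 ⊆ rightPerp1 𝒯 := fun T hT => hDefl ▸ ⟨T, hT, 𝟙 T, inferInstance⟩
  refine ⟨fun T hT X => ?_, h𝒯perp, fun V hV => ?_⟩
  · let S := ShortComplex.mk _ _ (cokernel.condition (Injective.ι X))
    have hS : S.ShortExact :=
      { exact := ShortComplex.exact_of_g_is_cokernel _ (cokernelIsCokernel S.f) }
    have hI : Injective.under X ∈ Defl 𝒯 :=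
      hDefl ▸ fun T' _ => Ext.subsingleton_of_injective T' _ 0
    obtain ⟨T', hT', p, hp⟩ := hI
    have hY : S.X₃ ∈ rightPerp1 𝒯 := hDefl ▸ ⟨T', hT', p ≫ S.g, epi_comp p S.g⟩
    have : Injective S.X₂ := inferInstanceAs (Injective (Injective.under X))
    have := hY T hT
    exact subsingleton_ext_succ_of_injective hS T 1
  · obtain ⟨T₀, hT₀, g, hg, hlift⟩ := happrox V hV
    let S := ShortComplex.mk _ _ (kernel.condition g)
    have hS : S.ShortExact :=
      { exact := ShortComplex.exact_of_f_is_kernel _ (kernelIsKernel S.g) }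
    refine ⟨kernel g, fun T hT => ?_, T₀, hT₀, kernel.ι g, g, kernel.condition g, hS⟩
    have : Subsingleton (Ext T S.X₂ 1) := h𝒯perp hT₀ T hT
    exact subsingleton_ext_one_of_lift hS T (hlift T hT)
end

section
/- Let T be a support τ-tilting subcategory of C such that every projective object P admits a short exact sequence 0 → P → T⁰ → T¹ → 0 with T⁰, T¹ ∈ T. Then Ext²(T,A) = 0 for every T ∈ T and every A ∈ C (i.e., pd(T) ≤ 1). -/
open CategoryTheory Category Limits Abelian

universe w v u

variable {C : Type u} [Category.{v} C] [Abelian C]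
  [EnoughProjectives C] [EnoughInjectives C] [HasExt.{w} C]

omit [Abelian C] [EnoughInjectives C] [HasExt.{w} C] in
/-- If every projective object embeds in an object of `𝒯`, then every injective object is a
quotient of an object of `𝒯`. -/
theorem injective_mem_defl {𝒯 : Set C}
    (h : ∀ P : C, Projective P → ∃ T ∈ 𝒯, ∃ f : P ⟶ T, Mono f) (I : C) [Injective I] :
    I ∈ Defl 𝒯 := by
  obtain ⟨T, hT, f, _⟩ := h (Projective.over I) inferInstance
  refine ⟨T, hT, Injective.factorThru (Projective.π I) f, ?_⟩
  have : Epi (f ≫ Injective.factorThru (Projective.π I) f) := by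
    rw [Injective.comp_factorThru]
    infer_instance
  exact epi_of_epi f _

omit [Abelian C] [EnoughProjectives C] [EnoughInjectives C] [HasExt.{w} C] in
/-- `Defl 𝒯` is closed under epimorphic images. -/
theorem defl_of_epi {𝒯 : Set C} {F G : C} (p : F ⟶ G) [Epi p] (hF : F ∈ Defl 𝒯) :
    G ∈ Defl 𝒯 := by
  obtain ⟨T, hT, g, _⟩ := hF
  exact ⟨T, hT, g ≫ p, epi_comp g p⟩

theorem stmt_6 (𝒯 : Set C) (h𝒯 : IsSubcat 𝒯)
    (hst : IsSupportTauTilting 𝒯)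
    (hP : ∀ P : C, Projective P → ∃ T₀ ∈ 𝒯, ∃ T₁ ∈ 𝒯, ∃ (f : P ⟶ T₀) (g : T₀ ⟶ T₁),
      IsShortExactSeq f g) :
    ∀ T ∈ 𝒯, ∀ A : C, Subsingleton (Ext T A 2) := by
  intro T hT A
  have hmono : ∀ P : C, Projective P → ∃ T ∈ 𝒯, ∃ f : P ⟶ T, Mono f := by
    intro P hproj
    obtain ⟨T₀, hT₀, _, _, f, _, _, hS⟩ := hP P hproj
    exact ⟨T₀, hT₀, f, hS.mono_f⟩
  have hcok : cokernel (Injective.ι A) ∈ Defl 𝒯 :=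
    defl_of_epi (cokernel.π _) (injective_mem_defl hmono (Injective.under A))
  have := hst.2.1 T hT _ hcok
  have hS : (ShortComplex.mk (Injective.ι A) _ (cokernel.condition _)).ShortExact :=
    { exact := ShortComplex.exact_cokernel _ }
  refine subsingleton_of_forall_eq 0 fun x => ?_
  obtain ⟨y, rfl⟩ := Ext.covariant_sequence_exact₁ T hS x
    (Ext.eq_zero_of_injective _) (n₀ := 1) rfl
  rw [Subsingleton.elim y 0, Ext.zero_comp]
end

section
/- Let T be a support τ-tilting subcategory of C. Then Defl(T) is closed under extensions: for every short exact sequence 0 → D¹ → A → D² → 0 with D¹, D² ∈ Defl(T), one has A ∈ Defl(T). -/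
open CategoryTheory Category Limits Abelian

universe w v u

variable {C : Type u} [Category.{v} C] [Abelian C]
  [EnoughProjectives C] [EnoughInjectives C] [HasExt.{w} C]

/-- A morphism `t : T ⟶ X₃` lifts along the epimorphism of a short exact sequence
`0 → X₁ → X₂ → X₃ → 0` when `Ext¹(T, X₁) = 0`. -/
theorem exists_lift_of_subsingleton_ext_one {C : Type u} [Category.{v} C] [Abelian C]
    [HasExt.{w} C] {S : ShortComplex C} (hS : S.ShortExact) {T : C}
    (hT : Subsingleton (Ext T S.X₁ 1)) (t : T ⟶ S.X₃) : ∃ l : T ⟶ S.X₂, l ≫ S.g = t := by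
  obtain ⟨x, hx⟩ := Ext.covariant_sequence_exact₃ T hS (Ext.mk₀ t) (zero_add 1)
    (Subsingleton.elim _ _)
  obtain ⟨l, rfl⟩ := (Ext.mk₀_bijective T S.X₂).2 x
  exact ⟨l, (Ext.mk₀_bijective T S.X₃).1 (by rw [← hx, Ext.mk₀_comp_mk₀])⟩

/-- For an exact sequence `X₁ → X₂ → X₃ → 0`, epimorphisms onto the outer terms, the second one
lifted to `X₂`, together give an epimorphism onto `X₂`. -/
theorem epi_biprod_desc_of_exact {C : Type u} [Category.{v} C] [Abelian C]
    {S : ShortComplex C} (hS : S.Exact) [Epi S.g] {T₁ T₂ : C} (t : T₁ ⟶ S.X₁) [Epi t]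
    (l : T₂ ⟶ S.X₂) [Epi (l ≫ S.g)] : Epi (biprod.desc (t ≫ S.f) l) := by
  refine Preadditive.epi_of_cancel_zero _ fun {Z} k hk ↦ ?_
  have hf : S.f ≫ k = 0 := by
    rw [← cancel_epi t, comp_zero, ← Category.assoc, ← biprod.inl_desc (t ≫ S.f) l,
      Category.assoc, hk, comp_zero]
  have hl : l ≫ k = 0 := by
    rw [← biprod.inr_desc (t ≫ S.f) l, Category.assoc, hk, comp_zero]
  have hd : S.g ≫ hS.desc k hf = k := hS.g_desc k hf
  have hz : hS.desc k hf = 0 := by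
    rw [← cancel_epi (l ≫ S.g), Category.assoc, hd, hl, comp_zero]
  rw [← hd, hz, comp_zero]

theorem stmt_7 (𝒯 : Set C) (h𝒯 : IsSubcat 𝒯) (hst : IsSupportTauTilting 𝒯) :
    ∀ ⦃D₁ A D₂ : C⦄ (f : D₁ ⟶ A) (g : A ⟶ D₂), IsShortExactSeq f g →
      D₁ ∈ Defl 𝒯 → D₂ ∈ Defl 𝒯 → A ∈ Defl 𝒯 := by
  rintro D₁ A D₂ f g ⟨w, hS⟩ hD₁ ⟨T₂, hT₂, t₂, ht₂⟩
  obtain ⟨l, rfl⟩ := exists_lift_of_subsingleton_ext_one hS (hst.2.1 T₂ hT₂ D₁ hD₁) t₂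
  obtain ⟨T₁, hT₁, t₁, ht₁⟩ := hD₁
  have := hS.epi_g
  exact ⟨T₁ ⊞ T₂, h𝒯.2.2 hT₁ hT₂, _, epi_biprod_desc_of_exact hS.exact t₁ l⟩
end

section
/- Let T be a support τ-tilting subcategory of C. Then (^⊥₁(Defl(T)), Defl(T)) is a τ-cotorsion pair in C, and Defl(T) is a torsion class (closed under extensions and under epimorphic images). -/
open CategoryTheory Category Limits Abelian

universe w v u

variable {C : Type u} [Category.{v} C] [Abelian C]
  [EnoughProjectives C] [EnoughInjectives C] [HasExt.{w} C]

/-- If `Ext¹(Y, A) = 0`, morphisms out of `Y` lift along the epimorphism of a short exact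
sequence with kernel `A`. -/
lemma IsShortExactSeq.exists_lift {A B X Y : C} {f : A ⟶ B} {g : B ⟶ X}
    (h : IsShortExactSeq f g) (hY : Subsingleton (Ext Y A 1)) (φ : Y ⟶ X) :
    ∃ ψ : Y ⟶ B, ψ ≫ g = φ := by
  obtain ⟨w, hS⟩ := h
  obtain ⟨x, hx⟩ := Ext.covariant_sequence_exact₃ Y hS (Ext.mk₀ φ) (zero_add 1)
    (Subsingleton.elim _ _)
  obtain ⟨ψ, rfl⟩ := (Ext.mk₀_bijective _ _).surjective x
  exact ⟨ψ, (Ext.mk₀_bijective _ _).injective ((Ext.mk₀_comp_mk₀ ψ g).symm.trans hx)⟩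

lemma subset_Defl (𝒯 : Set C) : 𝒯 ⊆ Defl 𝒯 :=
  fun T hT => ⟨T, hT, 𝟙 T, inferInstance⟩

lemma Defl_of_epi {𝒯 : Set C} {A B : C} (g : A ⟶ B) [Epi g] (hA : A ∈ Defl 𝒯) :
    B ∈ Defl 𝒯 := by
  obtain ⟨T, hT, p, hp⟩ := hA
  exact ⟨T, hT, p ≫ g, epi_comp p g⟩

/-- `Defl 𝒯` is closed under extensions when `𝒯` has binary sums and `Ext¹(𝒯, Defl 𝒯) = 0`. -/
lemma IsShortExactSeq.mem_Defl {𝒯 : Set C}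
    (hsum : ∀ ⦃X Y : C⦄, X ∈ 𝒯 → Y ∈ 𝒯 → (X ⊞ Y) ∈ 𝒯)
    (hext : ∀ T ∈ 𝒯, ∀ D ∈ Defl 𝒯, Subsingleton (Ext T D 1))
    {A B X : C} {f : A ⟶ B} {g : B ⟶ X} (h : IsShortExactSeq f g)
    (hA : A ∈ Defl 𝒯) (hX : X ∈ Defl 𝒯) : B ∈ Defl 𝒯 := by
  obtain ⟨T, hT, q, hq⟩ := hX
  obtain ⟨ψ, hψ⟩ := h.exists_lift (hext T hT A hA) q
  obtain ⟨T', hT', p, hp⟩ := hA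
  obtain ⟨w, hS⟩ := h
  refine ⟨T' ⊞ T, hsum hT' hT, biprod.desc (p ≫ f) ψ, ?_⟩
  refine Preadditive.epi_of_cancel_zero _ fun {Z} k hk => ?_
  have hf : f ≫ k = 0 := by
    rw [← cancel_epi p, comp_zero, ← assoc, ← biprod.inl_desc (p ≫ f) ψ, assoc, hk, comp_zero]
  have hψk : ψ ≫ k = 0 := by
    rw [← biprod.inr_desc (p ≫ f) ψ, assoc, hk, comp_zero]
  have := hS.epi_g
  obtain ⟨l, hl⟩ : ∃ l : X ⟶ Z, g ≫ l = k :=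
    ⟨hS.exact.desc k hf, hS.exact.g_desc k hf⟩
  have hl0 : l = 0 := by
    rw [← cancel_epi q, comp_zero, ← hψ, assoc, hl, hψk]
  rw [← hl, hl0, comp_zero]

/-- A left `𝒯`-approximation of a projective object is a left `Defl 𝒯`-approximation. -/
lemma IsLeftApprox.defl {𝒯 : Set C} {P T₀ : C} [Projective P] {f : P ⟶ T₀}
    (h : IsLeftApprox 𝒯 f) : IsLeftApprox (Defl 𝒯) f := by
  refine ⟨subset_Defl 𝒯 h.1, ?_⟩
  rintro D ⟨T, hT, q, hq⟩ φ
  obtain ⟨ψ, hψ⟩ := h.2 T hT (Projective.factorThru φ q)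
  exact ⟨ψ ≫ q, by rw [← assoc, hψ, Projective.factorThru_comp]⟩

theorem stmt_11 (𝒯 : Set C) (h𝒯 : IsSubcat 𝒯) (hst : IsSupportTauTilting 𝒯) :
    IsTauCotorsionPair (leftPerp1 (Defl 𝒯)) (Defl 𝒯) ∧ IsTorsionClass (Defl 𝒯) := by
  obtain ⟨-, hext, hproj⟩ := hst
  refine ⟨⟨rfl, fun P hP => ?_⟩,
    fun A B X f g h hA hX => h.mem_Defl h𝒯.2.2 hext hA hX,
    fun A B g hg hA => Defl_of_epi g hA⟩
  obtain ⟨T₀, hT₀, T₁, hT₁, f, g, hfg, happ⟩ := hproj P hP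
  exact ⟨T₀, ⟨hext T₀ hT₀, subset_Defl 𝒯 hT₀⟩, T₁, hext T₁ hT₁, f, g, hfg, happ.defl⟩
end

section
/- Let (U,V) be a τ-cotorsion pair in C such that V is a torsion class. Then U ∩ V is a support τ-tilting subcategory of C. -/
open CategoryTheory Category Limits Abelian

universe w v u

variable {C : Type u} [Category.{v} C] [Abelian C]
  [EnoughProjectives C] [EnoughInjectives C] [HasExt.{w} C]

omit [EnoughProjectives C] [EnoughInjectives C] in
/-- `^⊥₁𝒱` is closed under binary direct sums. -/
lemma biprod_mem_leftPerp1 {𝒱 : Set C} {X Y : C} (hX : X ∈ leftPerp1.{w} 𝒱)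
    (hY : Y ∈ leftPerp1.{w} 𝒱) : (X ⊞ Y) ∈ leftPerp1.{w} 𝒱 := by
  intro V hV
  have := hX V hV
  have := hY V hV
  exact ⟨fun α β ↦ Ext.biprod_ext (Subsingleton.elim _ _) (Subsingleton.elim _ _)⟩

omit [EnoughProjectives C] [EnoughInjectives C] [HasExt.{w} C] in
/-- A torsion class is closed under binary direct sums. -/
lemma IsTorsionClass.biprod_mem {𝒱 : Set C} (hV : IsTorsionClass 𝒱) {X Y : C}
    (hX : X ∈ 𝒱) (hY : Y ∈ 𝒱) : (X ⊞ Y) ∈ 𝒱 :=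
  hV.1 biprod.inl biprod.snd
    ⟨biprod.inl_snd, (ShortComplex.Splitting.ofHasBinaryBiproduct X Y).shortExact⟩ hX hY

omit [EnoughProjectives C] [EnoughInjectives C] [HasExt.{w} C] in
/-- Given `π : A ⟶ X` with kernel covered by `q : Q ⟶ A`, a factorization `q = f ≫ e` and an
epimorphism `c` killing `f`, a commutative square `c ≫ φ = e ≫ π` gives an exact sequence
`B ⟶ A ⊞ U ⟶ X`. -/
lemma exact_biprod_of_factorization {Q A B U X : C} {q : Q ⟶ A} {π : A ⟶ X} {f : Q ⟶ B}
    {e : B ⟶ A} {c : B ⟶ U} {φ : U ⟶ X} (hq : q ≫ π = 0)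
    (hqπ : (ShortComplex.mk q π hq).Exact) (hfe : f ≫ e = q) (hfc : f ≫ c = 0) [Epi c]
    (hφ : c ≫ φ = e ≫ π) :
    (ShortComplex.mk (biprod.lift e (-c)) (biprod.desc π φ) (by simp [hφ])).Exact := by
  rw [ShortComplex.exact_iff_exact_up_to_refinements] at hqπ ⊢
  intro W x hx
  dsimp at x hx
  obtain ⟨W₁, p₁, _, b, hb⟩ := surjective_up_to_refinements_of_epi c (x ≫ biprod.snd)
  have hx' : x ≫ biprod.fst ≫ π + x ≫ biprod.snd ≫ φ = 0 := by
    simpa [biprod.desc_eq] using hx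
  have hz : (p₁ ≫ x ≫ biprod.fst + b ≫ e) ≫ π = 0 := by
    have h₁ : b ≫ e ≫ π = p₁ ≫ x ≫ biprod.snd ≫ φ := by
      rw [← hφ, ← reassoc_of% hb]
    rw [Preadditive.add_comp, Category.assoc, Category.assoc, Category.assoc, h₁,
      ← Preadditive.comp_add, hx', comp_zero]
  obtain ⟨W₂, p₂, _, z, hz⟩ := hqπ _ hz
  dsimp at z hz
  refine ⟨W₂, p₂ ≫ p₁, inferInstance, z ≫ f - p₂ ≫ b, ?_⟩
  dsimp
  ext
  · simp [hfe, ← hz]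
  · simp [hfc, hb]

omit [EnoughInjectives C] in
/-- If `(𝒰, 𝒱)` is a `τ`-cotorsion pair, then every object of `𝒱` is a
quotient of an object of `𝒰 ∩ 𝒱`. -/
lemma IsTauCotorsionPair.subset_defl {𝒰 𝒱 : Set C} (h : IsTauCotorsionPair.{w} 𝒰 𝒱) :
    𝒱 ⊆ Defl (𝒰 ∩ 𝒱) := by
  intro X hX
  obtain ⟨V₀, hV₀, _, _, f, _, _, -, hf⟩ := h.2 (Projective.over X) inferInstance
  obtain ⟨π, hπ⟩ := hf X hX (Projective.π X)
  have : Epi (f ≫ π) := hπ ▸ inferInstance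
  exact ⟨V₀, hV₀, π, epi_of_epi f π⟩

omit [EnoughInjectives C] in
/-- If `(𝒰, 𝒱)` is a `τ`-cotorsion pair and `𝒱` is a torsion class, then `𝒰 ∩ 𝒱` is a generator
of `𝒱`. -/
lemma IsTauCotorsionPair.isGeneratorOf {𝒰 𝒱 : Set C} (h : IsTauCotorsionPair.{w} 𝒰 𝒱)
    (hV : IsTorsionClass 𝒱) : IsGeneratorOf (𝒰 ∩ 𝒱) 𝒱 := by
  refine ⟨Set.inter_subset_right, fun X hX ↦ ?_⟩
  obtain ⟨A, hA, π, _⟩ := h.subset_defl hX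
  let q : Projective.over (kernel π) ⟶ A := Projective.π (kernel π) ≫ kernel.ι π
  have hq : q ≫ π = 0 := by simp [q]
  have hqπ : (ShortComplex.mk q π hq).Exact := by
    rw [ShortComplex.exact_iff_epi_kernel_lift]
    have : kernel.lift π q hq = Projective.π (kernel π) := by
      rw [← cancel_mono (kernel.ι π), kernel.lift_ι]
    dsimp
    rw [this]
    infer_instance
  obtain ⟨B, hB, U, hU, f, c, ⟨hfc, hfc', _⟩, hf⟩ :=
    h.2 (Projective.over (kernel π)) inferInstance
  obtain ⟨e, he⟩ := hf.2 A hA.2 q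
  let φ : U ⟶ X := hfc'.desc (e ≫ π) (by rw [reassoc_of% he]; exact hq)
  have hφ : c ≫ φ = e ≫ π := hfc'.g_desc _ _
  have hexact := exact_biprod_of_factorization hq hqπ he hfc hφ
  have hepi := hexact.epi_kernelLift
  have hE : Epi (biprod.desc π φ) := by
    have : Epi (biprod.inl ≫ biprod.desc π φ) := by rwa [biprod.inl_desc]
    exact epi_of_epi biprod.inl _
  refine ⟨kernel (biprod.desc π φ), hV.2 _ hepi hB.2, A ⊞ U, ⟨?_, ?_⟩,
    kernel.ι _, biprod.desc π φ, kernel.condition _,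
    { exact := ShortComplex.exact_kernel _, mono_f := inferInstance, epi_g := hE }⟩
  · rw [h.1] at hA hU ⊢
    exact biprod_mem_leftPerp1 hA.1 hU
  · exact hV.biprod_mem hA.2 (hV.2 c inferInstance hB.2)

theorem stmt_12 (𝒰 𝒱 : Set C) (h : IsTauCotorsionPair 𝒰 𝒱) (hV : IsTorsionClass 𝒱) :
    IsSupportTauTilting (𝒰 ∩ 𝒱) := by
  have hD : Defl (𝒰 ∩ 𝒱) = 𝒱 :=
    Set.Subset.antisymm (fun _ ⟨_, hT, g, hg⟩ ↦ hV.2 g hg hT.2) h.subset_defl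
  refine ⟨hD.symm ▸ h.isGeneratorOf hV, fun T hT D hD' ↦ ?_, fun P hP ↦ ?_⟩
  · have hT' : T ∈ leftPerp1 𝒱 := h.1 ▸ hT.1
    exact hT' D (hD ▸ hD')
  · obtain ⟨V₀, hV₀, U₀, hU₀, f, g, hfg, hf⟩ := h.2 P hP
    have := hfg.2.2
    exact ⟨V₀, hV₀, U₀, ⟨hU₀, hV.2 g this hV₀.2⟩, f, g, hfg, hV₀, fun T hT ↦ hf.2 T hT.2⟩
end

section
/- Let (U,V) be a cotorsion pair in C such that V is a torsion class. Then U ∩ V is a tilting subcategory of C, i.e., pd(U ∩ V) ≤ 1 and U ∩ V is a generator of (U ∩ V)^⊥₁. -/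
open CategoryTheory Category Limits Abelian

universe w v u

variable {C : Type u} [Category.{v} C] [Abelian C]
  [EnoughProjectives C] [EnoughInjectives C] [HasExt.{w} C]

/-- If `X` is embedded in `Y` with cokernel `Z` and `Ext¹(Z, X) = 0`, the embedding splits. -/
lemma IsShortExactSeq.exists_retraction {X Y Z : C} {f : X ⟶ Y} {g : Y ⟶ Z}
    (hfg : IsShortExactSeq f g) (hZX : Subsingleton (Ext Z X 1)) :
    ∃ r : Y ⟶ X, f ≫ r = 𝟙 X := by
  obtain ⟨w, hS⟩ := hfg
  obtain ⟨x, hx⟩ := Ext.contravariant_sequence_exact₁ hS X (Ext.mk₀ (𝟙 X)) (add_zero 1)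
    (Subsingleton.elim (h := hZX) _ _)
  obtain ⟨r, rfl⟩ := (Ext.mk₀_bijective Y X).2 x
  exact ⟨r, (Ext.mk₀_bijective X X).1 (by simpa using hx)⟩

/-- If `X` is embedded in an object of a torsion class `𝒱` with cokernel `Z` and
`Ext¹(Z, X) = 0`, then `X` lies in `𝒱`. -/
lemma IsTorsionClass.mem_of_subsingleton_ext {𝒱 : Set C} (hV : IsTorsionClass 𝒱)
    {X Y Z : C} {f : X ⟶ Y} {g : Y ⟶ Z} (hfg : IsShortExactSeq f g) (hY : Y ∈ 𝒱)
    (hZX : Subsingleton (Ext Z X 1)) : X ∈ 𝒱 := by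
  obtain ⟨r, hr⟩ := hfg.exists_retraction hZX
  exact hV.2 r (SplitEpi.mk f hr).epi hY

/-- Dimension shifting along an embedding of `X` in an injective object. -/
lemma subsingleton_ext_two_of_injective {T X I : C} [Injective I] (i : X ⟶ I) [Mono i]
    (h : Subsingleton (Ext T (cokernel i) 1)) : Subsingleton (Ext T X 2) := by
  have hS : (ShortComplex.mk i (cokernel.π i) (cokernel.condition i)).ShortExact :=
    { exact := ShortComplex.exact_cokernel i }
  refine subsingleton_of_forall_eq 0 fun x ↦ ?_
  obtain ⟨y, rfl⟩ := Ext.covariant_sequence_exact₁ T hS x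
    (Ext.eq_zero_of_injective _) (one_add_one_eq_two)
  rw [Subsingleton.elim y 0, Ext.zero_comp]

theorem stmt_15 (𝒰 𝒱 : Set C) (h : IsCotorsionPair 𝒰 𝒱) (hV : IsTorsionClass 𝒱) :
    (∀ T ∈ 𝒰 ∩ 𝒱, ∀ X : C, Subsingleton (Ext T X 2)) ∧
    IsGeneratorOf (𝒰 ∩ 𝒱) (rightPerp1 (𝒰 ∩ 𝒱)) := by
  obtain ⟨-, -, hUV, hdefl, hinfl⟩ := h
  have hperp : rightPerp1 (𝒰 ∩ 𝒱) ⊆ 𝒱 := by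
    intro X hX
    obtain ⟨V', hV', U', hU', f, g, hfg⟩ := hinfl X
    have := hfg.choose_spec.epi_g
    exact hV.mem_of_subsingleton_ext hfg hV' (hX U' ⟨hU', hV.2 g this hV'⟩)
  refine ⟨fun T hT X ↦ ?_, fun T hT T' hT' ↦ hUV T' hT'.1 T hT.2, fun X hX ↦ ?_⟩
  · obtain ⟨V', hV', U', -, f, g, hfg⟩ := hinfl (Injective.under X)
    have hI : Injective.under X ∈ 𝒱 := hV.mem_of_subsingleton_ext hfg hV'
      (Ext.subsingleton_of_injective _ _ 0)
    exact subsingleton_ext_two_of_injective (Injective.ι X)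
      (hUV T hT.1 _ (hV.2 (cokernel.π (Injective.ι X)) inferInstance hI))
  · obtain ⟨V', hV', U', hU', f, g, hfg⟩ := hdefl X
    exact ⟨V', fun T hT ↦ hUV T hT.1 V' hV', U', ⟨hU', hV.1 f g hfg hV' (hperp hX)⟩, f, g, hfg⟩
end

section
/- Let T be a tilting subcategory of C, i.e., pd(T) ≤ 1 and T is a generator of T^⊥₁. Then every object X of C admits a short exact sequence 0 → X → W → T¹ → 0 with W ∈ Defl(T) and T¹ ∈ T. -/
open CategoryTheory Category Limits Abelian

universe w v u

variable {C : Type u} [Category.{v} C] [Abelian C]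
  [EnoughProjectives C] [EnoughInjectives C] [HasExt.{w} C]

/-- The base change of a short exact sequence `0 → A → B → X → 0` along `h : Y ⟶ X`. -/
theorem isShortExactSeq_pullback {C : Type u} [Category.{v} C] [Abelian C] {A B X Y : C}
    {f : A ⟶ B} {g : B ⟶ X} (hfg : IsShortExactSeq f g) (h : Y ⟶ X) :
    ∃ k : A ⟶ pullback g h, IsShortExactSeq k (pullback.snd g h) := by
  obtain ⟨w, hS⟩ := hfg
  have : Mono f := hS.mono_f
  have : Epi g := hS.epi_g
  have hk : pullback.lift f (0 : A ⟶ Y) (by simp [w]) ≫ pullback.snd g h = 0 :=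
    pullback.lift_snd _ _ _
  have : Mono (pullback.lift f (0 : A ⟶ Y) (by simp [w]) : A ⟶ pullback g h) :=
    mono_of_mono_fac (pullback.lift_fst _ _ _)
  refine ⟨_, hk, ?_⟩
  refine ShortComplex.ShortExact.mk' (ShortComplex.exact_of_f_is_kernel _ ?_) ‹_› inferInstance
  refine KernelFork.IsLimit.ofι' _ _ fun {Z} a ha ↦
    ⟨hS.exact.lift (a ≫ pullback.fst g h) (by simp [pullback.condition, reassoc_of% ha]), ?_⟩
  apply pullback.hom_ext
  · rw [assoc, pullback.lift_fst]
    exact hS.exact.lift_f (a ≫ pullback.fst g h) _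
  · rw [assoc, pullback.lift_snd, comp_zero, ha]

/-- The same base change, with the two factors of the fibre product exchanged. -/
theorem isShortExactSeq_pullback_symm {C : Type u} [Category.{v} C] [Abelian C] {A B X Y : C}
    {f : A ⟶ B} {g : B ⟶ X} (hfg : IsShortExactSeq f g) (h : Y ⟶ X) :
    ∃ k : A ⟶ pullback h g, IsShortExactSeq k (pullback.fst h g) := by
  obtain ⟨k, w, hS⟩ := isShortExactSeq_pullback hfg h
  refine ⟨k ≫ (pullbackSymmetry g h).hom, by simpa using w, ?_⟩
  refine ShortComplex.shortExact_of_iso (S₁ := ShortComplex.mk k (pullback.snd g h) w)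
    (ShortComplex.isoMk (Iso.refl _) (pullbackSymmetry g h) (Iso.refl _) ?_ ?_) hS
  · simp
  · simp

theorem rightPerp1_of_extension {C : Type u} [Category.{v} C] [Abelian C] [HasExt.{w} C]
    {𝒯 : Set C} {A B X : C} {f : A ⟶ B} {g : B ⟶ X} (hfg : IsShortExactSeq f g)
    (hA : A ∈ rightPerp1 𝒯) (hX : X ∈ rightPerp1 𝒯) : B ∈ rightPerp1 𝒯 := by
  obtain ⟨w, hS⟩ := hfg
  intro T hT
  have := hA T hT
  have := hX T hT
  refine subsingleton_of_forall_eq 0 fun e ↦ ?_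
  obtain ⟨e', rfl⟩ := Ext.covariant_sequence_exact₂ T hS e (Subsingleton.elim (α := Ext T X 1) _ _)
  rw [Subsingleton.elim (α := Ext T A 1) e' 0, Ext.zero_comp]

theorem rightPerp1_of_quotient {C : Type u} [Category.{v} C] [Abelian C] [HasExt.{w} C]
    {𝒯 : Set C} (hpd : ∀ T ∈ 𝒯, ∀ X : C, Subsingleton (Ext T X 2))
    {A B X : C} {f : A ⟶ B} {g : B ⟶ X} (hfg : IsShortExactSeq f g)
    (hB : B ∈ rightPerp1 𝒯) : X ∈ rightPerp1 𝒯 := by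
  obtain ⟨w, hS⟩ := hfg
  intro T hT
  have := hB T hT
  have := hpd T hT A
  refine subsingleton_of_forall_eq 0 fun e ↦ ?_
  obtain ⟨e', rfl⟩ := Ext.covariant_sequence_exact₃ T hS e (show 1 + 1 = 2 from rfl)
    (Subsingleton.elim (α := Ext T A 2) _ _)
  rw [Subsingleton.elim (α := Ext T B 1) e' 0, Ext.zero_comp]

theorem rightPerp1_subset_defl {C : Type u} [Category.{v} C] [Abelian C] [HasExt.{w} C]
    {𝒯 : Set C} (hgen : IsGeneratorOf 𝒯 (rightPerp1 𝒯)) : rightPerp1 𝒯 ⊆ Defl 𝒯 := by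
  intro V hV
  obtain ⟨_, _, U, hU, _, g, _, hS⟩ := hgen.2 V hV
  exact ⟨U, hU, g, hS.epi_g⟩

theorem stmt_16 (𝒯 : Set C) (h𝒯 : IsSubcat 𝒯)
    (hpd : ∀ T ∈ 𝒯, ∀ X : C, Subsingleton (Ext T X 2))
    (hgen : IsGeneratorOf 𝒯 (rightPerp1 𝒯)) :
    ∀ X : C, ∃ W ∈ Defl 𝒯, ∃ T₁ ∈ 𝒯, ∃ (f : X ⟶ W) (g : W ⟶ T₁),
      IsShortExactSeq f g := by
  intro X
  let p := cokernel.π (Injective.ι X)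
  have hX : IsShortExactSeq (Injective.ι X) p :=
    ⟨cokernel.condition _, .mk' (ShortComplex.exact_cokernel _) inferInstance inferInstance⟩
  have hI : Injective.under X ∈ rightPerp1 𝒯 := fun T _ ↦
    subsingleton_of_forall_eq 0 fun e ↦ e.eq_zero_of_injective
  obtain ⟨V, hV, T₁, hT₁, i, q, hq⟩ := hgen.2 _ (rightPerp1_of_quotient hpd hX hI)
  obtain ⟨f, hf⟩ := isShortExactSeq_pullback hX q
  obtain ⟨k, hk⟩ := isShortExactSeq_pullback_symm hq p
  exact ⟨_, rightPerp1_subset_defl hgen (rightPerp1_of_extension hk hV hI), T₁, hT₁, f, _, hf⟩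
end
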